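/- Let α, β, γ be integers with α ≥ 2γ, β ≥ γ ≥ 1 and α + β > 3, and let G be a finite group of order 2^(α+β) together with elements a, b such that G is generated by {a, b}, orderOf a = 2^α, orderOf b = 2^β, b⁻¹ a b = a^(1 + 2^(α−γ)), and the cyclic subgroups ⟨a⟩ and ⟨b⟩ intersect trivially (this is the group G₂ = ⟨a⟩ ⋊ ⟨b⟩). Then the ordered Davenport constant of G equals its Loewy length: D_o(G) = L(G) = 2^α + 2^β − 1. -/

import Mathlib

/-- A list (ordered sequence) over `G` is product-one free if no nonempty
order-preserving sublist has product equal to the identity. -/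
def OrderedProductOneFree {G : Type*} [Group G] (l : List G) : Prop :=
  ∀ t : List G, t.Sublist l → t ≠ [] → t.prod ≠ 1

/-- The ordered Davenport constant: the smallest `k` such that every list of
elements of `G` of length at least `k` has a nonempty sublist with product one. -/
noncomputable def orderedDavenport (G : Type*) [Group G] : ℕ :=
  sInf {k : ℕ | ∀ l : List G, k ≤ l.length → ¬ OrderedProductOneFree l}
/-- The Loewy length of a finite `p`-group `G`: the least positive integer `n` such that
the `n`-th power of the Jacobson radical of the group algebra `𝔽_p[G]` vanishes. -/
noncomputable def loewyLength (p : ℕ) (G : Type*) [Group G] : ℕ :=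
  sInf {n : ℕ | 0 < n ∧ (Ideal.jacobson (⊥ : Ideal (MonoidAlgebra (ZMod p) G))) ^ n = ⊥}

section NormalOrdering

variable {R : Type*} [Ring R]

/-- The additive span of the monomials `y ^ i * x ^ j` of total degree at least `n`
with `i ∈ S`. -/
def monomialSpan (x y : R) (S : Set ℕ) (n : ℕ) : AddSubgroup R :=
  AddSubgroup.closure {r | ∃ i ∈ S, ∃ j, n ≤ i + j ∧ r = y ^ i * x ^ j}

variable {x y : R} {S T : Set ℕ} {m n : ℕ} {w : R}

theorem monomial_mem_monomialSpan {i j : ℕ} (hi : i ∈ S) (h : n ≤ i + j) :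
    y ^ i * x ^ j ∈ monomialSpan x y S n :=
  AddSubgroup.subset_closure ⟨i, hi, j, h, rfl⟩

theorem monomialSpan_mono (hST : S ⊆ T) (hmn : m ≤ n) :
    monomialSpan x y S n ≤ monomialSpan x y T m := by
  refine (AddSubgroup.closure_le _).2 ?_
  rintro _ ⟨i, hi, j, h, rfl⟩
  exact monomial_mem_monomialSpan (hST hi) (hmn.trans h)

theorem map_mem_of_mem_monomialSpan (f : R →+ R) {K : AddSubgroup R}
    (h : ∀ i ∈ S, ∀ j, n ≤ i + j → f (y ^ i * x ^ j) ∈ K)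
    (hw : w ∈ monomialSpan x y S n) : f w ∈ K := by
  have : monomialSpan x y S n ≤ K.comap f := by
    refine (AddSubgroup.closure_le _).2 ?_
    rintro _ ⟨i, hi, j, hij, rfl⟩
    exact h i hi j hij
  exact this hw

theorem mul_pow_mem_monomialSpan (hw : w ∈ monomialSpan x y S n) (k : ℕ) :
    w * x ^ k ∈ monomialSpan x y S (n + k) := by
  refine map_mem_of_mem_monomialSpan (AddMonoidHom.mulRight (x ^ k)) (fun i hi j h => ?_) hw
  rw [AddMonoidHom.mulRight_apply, mul_assoc, ← pow_add]
  exact monomial_mem_monomialSpan hi (by omega)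

theorem left_mul_mem_monomialSpan (hST : ∀ i ∈ S, i + 1 ∈ T) (hw : w ∈ monomialSpan x y S n) :
    y * w ∈ monomialSpan x y T (n + 1) := by
  refine map_mem_of_mem_monomialSpan (AddMonoidHom.mulLeft y) (fun i hi j h => ?_) hw
  rw [AddMonoidHom.coe_mulLeft, ← mul_assoc, ← pow_succ']
  exact monomial_mem_monomialSpan (hST i hi) (by omega)

theorem right_mul_mem_monomialSpan_of_forall
    (h : ∀ i ∈ S, x * y ^ i ∈ monomialSpan x y S (i + 1)) (hw : w ∈ monomialSpan x y S n) :
    x * w ∈ monomialSpan x y S (n + 1) := by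
  refine map_mem_of_mem_monomialSpan (AddMonoidHom.mulLeft x) (fun i hi j hij => ?_) hw
  rw [AddMonoidHom.coe_mulLeft, ← mul_assoc]
  exact monomialSpan_mono subset_rfl (by omega) (mul_pow_mem_monomialSpan (h i hi) j)

theorem pow_mul_mem_of_forall_mul_mem {z : R} {V : ℕ → AddSubgroup R}
    (h : ∀ n, ∀ w ∈ V n, z * w ∈ V (n + 1)) (hw : w ∈ V n) (k : ℕ) : z ^ k * w ∈ V (n + k) := by
  induction k with
  | zero => simpa using hw
  | succ k ih =>
    rw [pow_succ', mul_assoc]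
    exact h _ _ ih

theorem mul_pow_mem_monomialSpan_Iic {q : ℕ} (hq : 2 ≤ q)
    (hxy : x * y = y * x + (1 + y) * (x ^ q + x ^ (q + 1))) (i : ℕ) :
    x * y ^ i ∈ monomialSpan x y (Set.Iic i) (i + 1) := by
  induction i using Nat.strong_induction_on with
  | _ i ih =>
    cases i with
    | zero =>
      have := monomial_mem_monomialSpan (x := x) (y := y) (S := Set.Iic 0) (n := 1)
        (i := 0) (j := 1) (by simp) (by simp)
      simpa using this
    | succ i =>
      have hx : ∀ n, ∀ w ∈ monomialSpan x y (Set.Iic i) n,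
          x * w ∈ monomialSpan x y (Set.Iic i) (n + 1) := fun n w =>
        right_mul_mem_monomialSpan_of_forall fun j hj =>
          monomialSpan_mono (Set.Iic_subset_Iic.2 hj) le_rfl (ih j (Nat.lt_succ_of_le hj))
      have hy : ∀ n, ∀ w ∈ monomialSpan x y (Set.Iic i) n,
          y * w ∈ monomialSpan x y (Set.Iic (i + 1)) (n + 1) := fun n w =>
        left_mul_mem_monomialSpan (by simp)
      have hpow : ∀ k, 2 ≤ k → x ^ k * y ^ i ∈ monomialSpan x y (Set.Iic i) (i + 2) := by
        intro k hk
        have hi : y ^ i ∈ monomialSpan x y (Set.Iic i) i := by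
          simpa using monomial_mem_monomialSpan (x := x) (y := y) (S := Set.Iic i) (n := i)
            (i := i) (j := 0) (by simp) (by simp)
        exact monomialSpan_mono subset_rfl (by omega) (pow_mul_mem_of_forall_mul_mem hx hi k)
      have hsum := add_mem (hpow q hq) (hpow (q + 1) (by omega))
      have key : x * y ^ (i + 1) = y * (x * y ^ i) + ((x ^ q * y ^ i + x ^ (q + 1) * y ^ i) +
          y * (x ^ q * y ^ i + x ^ (q + 1) * y ^ i)) := by
        rw [pow_succ', ← mul_assoc, hxy]
        noncomm_ring
      rw [key]
      refine add_mem (hy _ _ (ih i (Nat.lt_succ_self i))) (add_mem ?_ ?_)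
      · exact monomialSpan_mono (Set.Iic_subset_Iic.2 (Nat.le_succ i)) le_rfl hsum
      · exact monomialSpan_mono subset_rfl (by omega) (hy _ _ hsum)

theorem mul_mem_monomialSpan_univ {q : ℕ} (hq : 2 ≤ q)
    (hxy : x * y = y * x + (1 + y) * (x ^ q + x ^ (q + 1))) {v : R}
    (hv : v ∈ monomialSpan x y Set.univ m) (hw : w ∈ monomialSpan x y Set.univ n) :
    v * w ∈ monomialSpan x y Set.univ (m + n) := by
  have hx : ∀ n, ∀ w ∈ monomialSpan x y Set.univ n, x * w ∈ monomialSpan x y Set.univ (n + 1) :=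
    fun n w => right_mul_mem_monomialSpan_of_forall fun i _ =>
      monomialSpan_mono (Set.subset_univ _) le_rfl (mul_pow_mem_monomialSpan_Iic hq hxy i)
  have hy : ∀ n, ∀ w ∈ monomialSpan x y Set.univ n, y * w ∈ monomialSpan x y Set.univ (n + 1) :=
    fun n w => left_mul_mem_monomialSpan (by simp)
  refine map_mem_of_mem_monomialSpan (AddMonoidHom.mulRight w) (fun i _ j h => ?_) hv
  rw [AddMonoidHom.mulRight_apply, mul_assoc]
  exact monomialSpan_mono subset_rfl (by omega)
    (pow_mul_mem_of_forall_mul_mem hy (pow_mul_mem_of_forall_mul_mem hx hw j) i)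

theorem eq_zero_of_mem_monomialSpan {r s : ℕ} (hx : x ^ r = 0) (hy : y ^ s = 0)
    (hn : r + s ≤ n + 1) (hw : w ∈ monomialSpan x y S n) : w = 0 := by
  have := map_mem_of_mem_monomialSpan (AddMonoidHom.id R) (K := ⊥) (fun i _ j h => ?_) hw
  · simpa using this
  rw [AddMonoidHom.id_apply, AddSubgroup.mem_bot]
  rcases le_or_gt r j with hj | hj
  · rw [pow_eq_zero_of_le hj hx, mul_zero]
  · rw [pow_eq_zero_of_le (by omega : s ≤ i) hy, zero_mul]

end NormalOrdering

section Jacobson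

variable {R : Type*} [Ring R]

theorem le_jacobson_bot_of_pow_eq_bot {I : Ideal R} {n : ℕ} (h : I ^ n = ⊥) :
    I ≤ Ideal.jacobson ⊥ := by
  intro r hr
  refine Ideal.mem_jacobson_iff.2 fun y => ?_
  have hnil : IsNilpotent (y * r) := ⟨n, by
    have := Ideal.pow_mem_pow (I.mul_mem_left y hr) n
    rwa [h, Ideal.mem_bot] at this⟩
  obtain ⟨z, hz⟩ := hnil.isUnit_add_one.exists_left_inv
  refine ⟨z, ?_⟩
  rw [Ideal.mem_bot, ← hz]
  noncomm_ring

theorem jacobson_bot_le_ker {K : Type*} [Field K] {ε : R →+* K} (hε : Function.Surjective ε) :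
    Ideal.jacobson ⊥ ≤ RingHom.ker ε := by
  intro r hr
  rw [RingHom.mem_ker]
  by_contra hne
  obtain ⟨y, hy⟩ := hε (-(ε r)⁻¹)
  obtain ⟨z, hz⟩ := Ideal.mem_jacobson_iff.1 hr y
  have := congrArg ε ((Ideal.mem_bot).1 hz)
  simp [hy, mul_assoc, hne] at this

theorem pow_succ_le_of_mul_mem {I : Ideal R} {V : ℕ → AddSubgroup R} (h1 : ∀ r ∈ I, r ∈ V 1)
    (hmul : ∀ n, ∀ r ∈ V n, ∀ s ∈ V 1, r * s ∈ V (n + 1)) (n : ℕ) :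
    ∀ r ∈ I ^ (n + 1), r ∈ V (n + 1) := by
  induction n with
  | zero => simpa [Submodule.pow_one] using h1
  | succ n ih =>
    intro r hr
    rw [Submodule.pow_succ] at hr
    exact Submodule.smul_induction_on hr (fun s hs t ht => hmul _ s (ih s hs) t (h1 t ht))
      fun _ _ => add_mem

theorem list_prod_mem_pow {I : Ideal R} (l : List R) (h : ∀ r ∈ l, r ∈ I) :
    l.prod ∈ I ^ l.length := by
  induction l using List.reverseRecOn with
  | nil => simp [Submodule.pow_zero]
  | append_singleton l r ih =>
    rw [List.prod_append, List.prod_singleton, List.length_append, List.length_singleton,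
      Submodule.pow_succ]
    exact Ideal.mul_mem_mul (ih fun s hs => h s (by simp [hs])) (h r (by simp))

end Jacobson

section ProductOneFree

open MonoidAlgebra

variable (k : Type*) {G : Type*} [CommRing k] [Group G]

theorem exists_sublist_prod_eq_of_coeff_ne_zero (l : List G) (h : G)
    (hh : (l.map fun g => (of k G g - 1 : MonoidAlgebra k G)).prod.coeff h ≠ 0) :
    ∃ t : List G, t.Sublist l ∧ t.prod = h := by
  induction l generalizing h with
  | nil =>
    refine ⟨[], List.Sublist.refl _, ?_⟩
    by_contra hne
    apply hh
    rw [List.prod_nil] at hne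
    simp [one_def, hne]
  | cons g l ih =>
    rw [List.map_cons, List.prod_cons, sub_mul, one_mul, of_apply, coeff_sub, Finsupp.sub_apply,
      coeff_single_mul_apply, one_mul] at hh
    by_cases h0 : (l.map fun g => (of k G g - 1 : MonoidAlgebra k G)).prod.coeff h = 0
    · obtain ⟨t, ht, hp⟩ := ih (g⁻¹ * h) (by rwa [h0, sub_zero] at hh)
      exact ⟨g :: t, ht.cons_cons g, by simp [hp]⟩
    · obtain ⟨t, ht, hp⟩ := ih h h0
      exact ⟨t, ht.cons g, hp⟩

theorem OrderedProductOneFree.sublist {l l' : List G} (hl : OrderedProductOneFree l)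
    (h : l'.Sublist l) : OrderedProductOneFree l' :=
  fun t ht => hl t (ht.trans h)

theorem OrderedProductOneFree.prod_of_sub_one_ne_zero [Nontrivial k] {l : List G}
    (hl : OrderedProductOneFree l) :
    (l.map fun g => (of k G g - 1 : MonoidAlgebra k G)).prod ≠ 0 := by
  suffices (l.map fun g => (of k G g - 1 : MonoidAlgebra k G)).prod.coeff 1 ≠ 0 by
    intro h
    rw [h, coeff_zero] at this
    exact this rfl
  induction l with
  | nil => simp
  | cons g l ih =>
    have h0 : (l.map fun g => (of k G g - 1 : MonoidAlgebra k G)).prod.coeff (g⁻¹ * 1) = 0 := by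
      by_contra hne
      obtain ⟨t, ht, hp⟩ := exists_sublist_prod_eq_of_coeff_ne_zero k l _ hne
      exact hl (g :: t) (ht.cons_cons g) (by simp) (by simp [hp])
    rw [List.map_cons, List.prod_cons, sub_mul, one_mul, of_apply, coeff_sub, Finsupp.sub_apply,
      coeff_single_mul_apply, one_mul, h0, zero_sub, neg_ne_zero]
    exact ih (hl.sublist (List.sublist_cons_self g l))

theorem OrderedProductOneFree.length_lt [Nontrivial k] {l : List G}
    (hl : OrderedProductOneFree l) {I : Ideal (MonoidAlgebra k G)}
    (hI : ∀ g : G, of k G g - 1 ∈ I) {n : ℕ} (hn : I ^ n = ⊥) : l.length < n := by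
  by_contra! hlen
  refine (hl.sublist (List.take_sublist n l)).prod_of_sub_one_ne_zero k ?_
  have := list_prod_mem_pow (I := I)
    ((l.take n).map fun g => (of k G g - 1 : MonoidAlgebra k G)) (by
      intro r hr
      obtain ⟨g, -, rfl⟩ := List.mem_map.1 hr
      exact hI g)
  rwa [List.length_map, List.length_take, min_eq_left hlen, hn, Ideal.mem_bot] at this

theorem orderedProductOneFree_replicate_append_replicate [Finite G] {a b : G}
    (hint : Subgroup.zpowers a ⊓ Subgroup.zpowers b = ⊥) :
    OrderedProductOneFree
      (List.replicate (orderOf a - 1) a ++ List.replicate (orderOf b - 1) b) := by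
  intro t ht hne hprod
  obtain ⟨t₁, t₂, rfl, h₁, h₂⟩ := List.sublist_append_iff.1 ht
  obtain ⟨i, hi, rfl⟩ := List.sublist_replicate_iff.1 h₁
  obtain ⟨j, hj, rfl⟩ := List.sublist_replicate_iff.1 h₂
  rw [List.prod_append, List.prod_replicate, List.prod_replicate] at hprod
  have ha : a ^ i = 1 := by
    rw [← Subgroup.mem_bot, ← hint, Subgroup.mem_inf]
    refine ⟨Subgroup.npow_mem_zpowers a i, ?_⟩
    rw [eq_inv_of_mul_eq_one_left hprod]
    exact inv_mem (Subgroup.npow_mem_zpowers b j)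
  rw [ha, one_mul] at hprod
  have hapos := orderOf_pos a
  have hbpos := orderOf_pos b
  have hi0 : i = 0 := Nat.eq_zero_of_dvd_of_lt (orderOf_dvd_of_pow_eq_one ha) (by omega)
  have hj0 : j = 0 := Nat.eq_zero_of_dvd_of_lt (orderOf_dvd_of_pow_eq_one hprod) (by omega)
  exact hne (by simp [hi0, hj0])

end ProductOneFree

section Augmentation

open MonoidAlgebra

/-- The augmentation map `k[G] → k`, sending every group element to `1`. -/
noncomputable def augmentation (k G : Type*) [CommRing k] [Group G] : MonoidAlgebra k G →ₐ[k] k :=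
  lift k k G 1

theorem of_sub_one_mem_ker_augmentation {k G : Type*} [CommRing k] [Group G] (g : G) :
    of k G g - 1 ∈ RingHom.ker (augmentation k G) := by
  simp [RingHom.mem_ker, augmentation]

theorem augmentation_surjective (k G : Type*) [CommRing k] [Group G] :
    Function.Surjective (augmentation k G) :=
  fun c => ⟨algebraMap k _ c, AlgHom.commutes _ c⟩

theorem mem_of_mem_ker_augmentation {p : ℕ} {G : Type*} [Group G]
    {V : AddSubgroup (MonoidAlgebra (ZMod p) G)} (hV : ∀ g, of (ZMod p) G g - 1 ∈ V)
    {r : MonoidAlgebra (ZMod p) G} (hr : r ∈ RingHom.ker (augmentation (ZMod p) G)) : r ∈ V := by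
  have key (r) : r - algebraMap (ZMod p) _ (augmentation (ZMod p) G r) ∈ V := by
    induction r using MonoidAlgebra.induction_on with
    | of g =>
      rw [augmentation, lift_of, MonoidHom.one_apply, map_one]
      exact hV g
    | add r s hr hs =>
      rw [map_add, map_add, add_sub_add_comm]
      exact add_mem hr hs
    | smul c r hr =>
      rw [map_smul, smul_eq_mul, map_mul, ← Algebra.smul_def, ← smul_sub]
      exact ZMod.smul_mem hr c
  have := key r
  rwa [(RingHom.mem_ker).1 hr, map_zero, sub_zero] at this

theorem of_sub_one_mem_of_closure_eq_top {k G : Type*} [CommRing k] [Group G] [Finite G]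
    {V : AddSubgroup (MonoidAlgebra k G)} (hmul : ∀ v ∈ V, ∀ w ∈ V, v * w ∈ V) {s : Set G}
    (hs : Subgroup.closure s = ⊤) (hV : ∀ g ∈ s, of k G g - 1 ∈ V) (g : G) :
    of k G g - 1 ∈ V := by
  have hg : g ∈ Submonoid.closure s := by
    rw [← Subgroup.closure_toSubmonoid_of_finite, hs]
    trivial
  induction hg using Submonoid.closure_induction with
  | mem g hg => exact hV g hg
  | one => rw [map_one, sub_self]; exact zero_mem V
  | mul g h _ _ ihg ihh =>
    have : of k G (g * h) - 1 =
        (of k G g - 1) * (of k G h - 1) + (of k G g - 1) + (of k G h - 1) := by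
      rw [map_mul]
      noncomm_ring
    rw [this]
    exact add_mem (add_mem (hmul _ ihg _ ihh) ihg) ihh

theorem of_sub_one_pow_two_pow {G : Type*} [Group G] (g : G) (n : ℕ) :
    (of (ZMod 2) G g - 1) ^ 2 ^ n = of (ZMod 2) G (g ^ 2 ^ n) - 1 := by
  have : CharP (MonoidAlgebra (ZMod 2) G) 2 := charP_of_injective_algebraMap' (ZMod 2) 2
  rw [sub_pow_char_pow_of_commute 2 n (Commute.one_right _), one_pow, map_pow]

theorem of_sub_one_mul_of_sub_one {G : Type*} [Group G] {a b : G} {n : ℕ}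
    (h : b⁻¹ * a * b = a ^ (1 + 2 ^ n)) :
    (of (ZMod 2) G a - 1) * (of (ZMod 2) G b - 1) =
      (of (ZMod 2) G b - 1) * (of (ZMod 2) G a - 1) + (1 + (of (ZMod 2) G b - 1)) *
        ((of (ZMod 2) G a - 1) ^ 2 ^ n + (of (ZMod 2) G a - 1) ^ (2 ^ n + 1)) := by
  have hab : of (ZMod 2) G a * of (ZMod 2) G b =
      of (ZMod 2) G b * of (ZMod 2) G a * of (ZMod 2) G (a ^ 2 ^ n) := by
    rw [← map_mul, ← map_mul, ← map_mul, mul_assoc, ← pow_succ', add_comm, ← h]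
    group
  rw [pow_succ', of_sub_one_pow_two_pow]
  have hexp : ∀ A B C : MonoidAlgebra (ZMod 2) G, A * B = B * A * C →
      (A - 1) * (B - 1) =
        (B - 1) * (A - 1) + (1 + (B - 1)) * ((C - 1) + (A - 1) * (C - 1)) := by
    intro A B C h
    have : (A - 1) * (B - 1) = A * B - A - B + 1 := by noncomm_ring
    rw [this, h]
    noncomm_ring
  exact hexp _ _ _ hab

theorem ker_augmentation_pow_eq_bot {G : Type*} [Group G] [Finite G] {a b : G} {α β n : ℕ}
    (hn : n ≠ 0) (hgen : Subgroup.closure {a, b} = ⊤) (ha : a ^ 2 ^ α = 1) (hb : b ^ 2 ^ β = 1)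
    (hconj : b⁻¹ * a * b = a ^ (1 + 2 ^ n)) :
    RingHom.ker (augmentation (ZMod 2) G) ^ (2 ^ α + 2 ^ β - 1) = ⊥ := by
  set x := of (ZMod 2) G a - 1 with hx
  set y := of (ZMod 2) G b - 1 with hy
  have hmul : ∀ m n, ∀ v ∈ monomialSpan x y Set.univ m, ∀ w ∈ monomialSpan x y Set.univ n,
      v * w ∈ monomialSpan x y Set.univ (m + n) := fun m n v hv w hw =>
    mul_mem_monomialSpan_univ (Nat.le_self_pow hn 2) (of_sub_one_mul_of_sub_one hconj) hv hw
  have hmem : ∀ g, of (ZMod 2) G g - 1 ∈ monomialSpan x y Set.univ 1 := by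
    refine of_sub_one_mem_of_closure_eq_top
      (fun v hv w hw => monomialSpan_mono subset_rfl (by omega) (hmul 1 1 v hv w hw)) hgen ?_
    rintro g (rfl | rfl)
    · simpa [-of_apply] using monomial_mem_monomialSpan (x := x) (y := y) (S := Set.univ) (n := 1)
        (i := 0) (j := 1) trivial (by simp)
    · simpa [-of_apply] using monomial_mem_monomialSpan (x := x) (y := y) (S := Set.univ) (n := 1)
        (i := 1) (j := 0) trivial (by simp)
  have hα : 0 < 2 ^ α := by positivity
  have hβ : 0 < 2 ^ β := by positivity
  obtain ⟨N, hN⟩ : ∃ N, 2 ^ α + 2 ^ β - 1 = N + 1 := ⟨2 ^ α + 2 ^ β - 2, by omega⟩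
  rw [eq_bot_iff, hN]
  intro r hr
  have hxz : x ^ 2 ^ α = 0 := by rw [hx, of_sub_one_pow_two_pow, ha, map_one, sub_self]
  have hyz : y ^ 2 ^ β = 0 := by rw [hy, of_sub_one_pow_two_pow, hb, map_one, sub_self]
  refine eq_zero_of_mem_monomialSpan hxz hyz (by omega) (pow_succ_le_of_mul_mem
    (fun r hr => mem_of_mem_ker_augmentation hmem hr) (fun n => hmul n 1) N r hr)

end Augmentation

/-- For the group `G₂ = ⟨a⟩ ⋊ ⟨b⟩` as above, the ordered Davenport
constant equals the Loewy length: `D_o(G) = L(G) = 2^α + 2^β - 1`. -/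
theorem orderedDavenport_eq_loewyLength_G2 (α β γ : ℕ) (h1 : 2 * γ ≤ α) (h2 : γ ≤ β) (h3 : 1 ≤ γ) (h4 : 3 < α + β)
    (G : Type*) [Group G] [Fintype G] (a b : G)
    (hcard : Fintype.card G = 2 ^ (α + β))
    (hgen : Subgroup.closure {a, b} = ⊤)
    (hoa : orderOf a = 2 ^ α) (hob : orderOf b = 2 ^ β)
    (hconj : b⁻¹ * a * b = a ^ (1 + 2 ^ (α - γ)))
    (hint : Subgroup.zpowers a ⊓ Subgroup.zpowers b = ⊥) :
    orderedDavenport G = loewyLength 2 G ∧ loewyLength 2 G = 2 ^ α + 2 ^ β - 1 := by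
  have hker := ker_augmentation_pow_eq_bot (by omega : α - γ ≠ 0) hgen
    (hoa ▸ pow_orderOf_eq_one a) (hob ▸ pow_orderOf_eq_one b) hconj
  have hJ : Ideal.jacobson (⊥ : Ideal (MonoidAlgebra (ZMod 2) G)) =
      RingHom.ker (augmentation (ZMod 2) G) :=
    le_antisymm (jacobson_bot_le_ker (augmentation_surjective (ZMod 2) G))
      (le_jacobson_bot_of_pow_eq_bot hker)
  have hα : 0 < 2 ^ α := by positivity
  have hβ : 0 < 2 ^ β := by positivity
  have hfree := orderedProductOneFree_replicate_append_replicate hint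
  have hlen : (List.replicate (orderOf a - 1) a ++ List.replicate (orderOf b - 1) b).length + 1 =
      2 ^ α + 2 ^ β - 1 := by
    rw [List.length_append, List.length_replicate, List.length_replicate, hoa, hob]
    omega
  have hL : loewyLength 2 G = 2 ^ α + 2 ^ β - 1 := by
    refine IsLeast.csInf_eq ⟨⟨by omega, hJ ▸ hker⟩, fun n hn => ?_⟩
    rw [← hlen]
    exact hfree.length_lt (ZMod 2) of_sub_one_mem_ker_augmentation (hJ ▸ hn.2)
  have hD : orderedDavenport G = 2 ^ α + 2 ^ β - 1 := by
    refine IsLeast.csInf_eq ⟨fun l hl hlfree => ?_, fun n hn => ?_⟩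
    · exact hl.not_gt (hlfree.length_lt (ZMod 2) of_sub_one_mem_ker_augmentation hker)
    · rw [← hlen]
      by_contra! h
      exact hn _ (Nat.le_of_lt_succ h) hfree
  exact ⟨hD.trans hL.symm, hL⟩
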